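/- Let $T_n : [0,1)^d \to [0,1)^d$ be the map $T_n(t)_j = n_j t_j \bmod 1$ for $n = (n_1,\dots,n_d) \in \mathbb{Z}_{>0}^d$. For all Borel subsets $E, F \subset [0,1)^d$, $\lim_{n \to \infty} \mu_L(T_n^{-1}(E) \cap F) = \mu_L(E)\,\mu_L(F)$, where the limit is along the directed set $\mathbb{Z}_{>0}^d$. -/

import Mathlib

open MeasureTheory Set

open scoped symmDiff ENNReal Topology

/-- Translation modulo `1` preserves Lebesgue measure on `[0,1)`. -/
theorem measurePreserving_fract_add_Ico (x : ℝ) :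
    MeasurePreserving (fun s : ℝ => Int.fract (x + s))
      (volume.restrict (Ico (0 : ℝ) 1)) (volume.restrict (Ico (0 : ℝ) 1)) := by
  have hm : Measurable (fun s : ℝ => Int.fract (x + s)) :=
    measurable_fract.comp (measurable_const_add x)
  refine ⟨hm, ?_⟩
  ext A hA
  rw [Measure.map_apply hm hA, restrict_Ico_eq_restrict_Ioc, Measure.restrict_apply (hm hA),
    Measure.restrict_apply hA]
  set B : Set ℝ := Int.fract ⁻¹' A with hB_def
  have hB : MeasurableSet B := measurable_fract hA
  have hinv : ∀ g : AddSubgroup.zmultiples (1 : ℝ), (fun y => g +ᵥ y) ⁻¹' B = B := by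
    rintro ⟨_, k, rfl⟩
    ext y
    simp [hB_def, AddSubgroup.vadd_def]
  calc volume ((fun s => Int.fract (x + s)) ⁻¹' A ∩ Ioc 0 1)
      = volume ((fun s => x + s) ⁻¹' (B ∩ Ioc x (x + 1))) := by
        congr 1
        ext s
        simp [hB_def]
    _ = volume (B ∩ Ioc x (x + 1)) := measure_preimage_add _ _ _
    _ = volume (B ∩ Ioc 0 (0 + 1)) :=
        (isAddFundamentalDomain_Ioc one_pos x).measure_set_eq
          (isAddFundamentalDomain_Ioc one_pos 0) hB hinv
    _ = volume (B ∩ Ico 0 1) := by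
        rw [zero_add]
        exact measure_congr ((ae_eq_refl B).inter Ico_ae_eq_Ioc.symm)
    _ = volume (A ∩ Ico 0 1) := by
        congr 1
        ext s
        simp only [hB_def, mem_inter_iff, mem_preimage, and_congr_left_iff]
        intro hs
        rw [Int.fract_eq_self.2 hs]
    _ = volume (A ∩ Ioc 0 1) := measure_congr ((ae_eq_refl A).inter Ico_ae_eq_Ioc)

/-- Translation modulo `1` preserves Lebesgue measure on the half-open unit cube. -/
theorem measurePreserving_fract_add_unitCube {ι : Type*} [Fintype ι] (x : ι → ℝ) :
    MeasurePreserving (fun (s : ι → ℝ) j => Int.fract (x j + s j))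
      (volume.restrict (univ.pi fun _ => Ico (0 : ℝ) 1))
      (volume.restrict (univ.pi fun _ => Ico (0 : ℝ) 1)) := by
  rw [volume_pi, Measure.restrict_pi_pi]
  exact measurePreserving_pi _ _ fun j => measurePreserving_fract_add_Ico (x j)

/-- Translations are continuous for the measure of symmetric differences. -/
theorem tendsto_volume_sub_preimage_symmDiff {ι : Type*} [Fintype ι] {F : Set (ι → ℝ)}
    (hF : MeasurableSet F) (hF' : volume F ≠ ∞) :
    Filter.Tendsto (fun v : ι → ℝ => volume (((fun t => t - v) ⁻¹' F) ∆ F)) (𝓝 0) (𝓝 0) := by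
  let f : C(ι → ℝ, C(ι → ℝ, ι → ℝ)) :=
    ContinuousMap.curry ⟨fun p : (ι → ℝ) × (ι → ℝ) => p.2 - p.1, by fun_prop⟩
  have h := tendsto_measure_symmDiff_preimage_nhds_zero (μ := volume) (ν := volume) (s := F)
    (f.continuous.tendsto 0)
    (.of_forall fun v => measurePreserving_sub_right volume v)
    (measurePreserving_sub_right volume 0) hF.nullMeasurableSet hF'
  have h0 : (f 0 : (ι → ℝ) → ι → ℝ) ⁻¹' F = F := by
    ext t
    simp [f]
  rw [h0] at h
  exact h

theorem measure_inter_le_add_symmDiff {α : Type*} [MeasurableSpace α] (μ : Measure α)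
    (P A B : Set α) : μ (P ∩ A) ≤ μ (P ∩ B) + μ (A ∆ B) := by
  refine (measure_mono fun x hx => ?_).trans (measure_union_le _ _)
  by_cases hB : x ∈ B
  · exact .inl ⟨hx.1, hB⟩
  · exact .inr (.inl ⟨hx.2, hB⟩)

/-- Averaging the preimages of `E` under the shifted maps `t ↦ n t + s mod 1` over the shift `s`
gives exact independence from `F`. -/
theorem lintegral_volume_fract_preimage_inter {ι : Type*} [Fintype ι] {E F : Set (ι → ℝ)}
    (hE : MeasurableSet E) (hEsub : E ⊆ univ.pi fun _ => Ico (0 : ℝ) 1)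
    (hF : volume F ≠ ∞) (n : ι → ℝ) :
    ∫⁻ s in univ.pi fun _ => Ico (0 : ℝ) 1,
      volume ({t | (fun j => Int.fract (n j * t j + s j)) ∈ E} ∩ F) = volume E * volume F := by
  have : IsFiniteMeasure (volume.restrict F) := ⟨by simpa using hF.lt_top⟩
  set S : Set ((ι → ℝ) × (ι → ℝ)) :=
    (fun p j => Int.fract (n j * p.2 j + p.1 j)) ⁻¹' E with hS_def
  have hg : Measurable (fun (p : (ι → ℝ) × (ι → ℝ)) j => Int.fract (n j * p.2 j + p.1 j)) :=
    measurable_pi_lambda _ fun j => measurable_fract.comp (by fun_prop)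
  have hS : MeasurableSet S := hg hE
  have h1 := Measure.prod_apply (μ := volume.restrict (univ.pi fun _ : ι => Ico (0 : ℝ) 1))
    (ν := volume.restrict F) hS
  rw [Measure.prod_apply_symm hS] at h1
  have h2 : ∀ s : ι → ℝ, volume.restrict F (Prod.mk s ⁻¹' S) =
      volume ({t | (fun j => Int.fract (n j * t j + s j)) ∈ E} ∩ F) := fun s =>
    Measure.restrict_apply (measurable_prodMk_left hS)
  have h3 : ∀ t : ι → ℝ, volume.restrict (univ.pi fun _ : ι => Ico (0 : ℝ) 1)
      ((fun s => (s, t)) ⁻¹' S) = volume E := fun t => by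
    have := (measurePreserving_fract_add_unitCube fun j => n j * t j).measure_preimage
      hE.nullMeasurableSet
    rw [Measure.restrict_apply hE, inter_eq_left.2 hEsub] at this
    exact this
  simp only [h2, h3, lintegral_const, Measure.restrict_apply_univ] at h1
  exact h1.symm

/-- The quantitative mixing estimate: the defect is controlled by the symmetric difference of `F`
with its translates by the vectors `s / n`. -/
theorem volume_fract_preimage_inter_bounds {ι : Type*} [Fintype ι] {E F : Set (ι → ℝ)}
    (hE : MeasurableSet E) (hEsub : E ⊆ univ.pi fun _ => Ico (0 : ℝ) 1)
    (hF : volume F ≠ ∞) (n : ι → ℝ) (hn : ∀ j, n j ≠ 0) {δ : ℝ≥0∞}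
    (hδ : ∀ s ∈ univ.pi fun _ : ι => Ico (0 : ℝ) 1,
      volume (((fun t => t - fun j => s j / n j) ⁻¹' F) ∆ F) ≤ δ) :
    volume ({t | (fun j => Int.fract (n j * t j)) ∈ E} ∩ F) ≤ volume E * volume F + δ ∧
      volume E * volume F ≤ volume ({t | (fun j => Int.fract (n j * t j)) ∈ E} ∩ F) + δ := by
  set Q : Set (ι → ℝ) := univ.pi fun _ => Ico (0 : ℝ) 1
  have hQ : MeasurableSet Q := .univ_pi fun _ => measurableSet_Ico
  have hQ1 : volume Q = 1 := by simp [Q, volume_pi_pi]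
  set P : Set (ι → ℝ) := {t | (fun j => Int.fract (n j * t j)) ∈ E}
  have hshift : ∀ s : ι → ℝ, volume ({t | (fun j => Int.fract (n j * t j + s j)) ∈ E} ∩ F) =
      volume (P ∩ (fun t => t - fun j => s j / n j) ⁻¹' F) := fun s => by
    rw [← measure_preimage_add_right volume (fun j => s j / n j)
      (P ∩ (fun t => t - fun j => s j / n j) ⁻¹' F)]
    congr 1
    ext t
    have : ∀ j, n j * (t j + s j / n j) = n j * t j + s j := fun j => by
      field_simp [hn j]
    simp [P, this]
  have hint := lintegral_volume_fract_preimage_inter hE hEsub hF n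
  simp only [hshift] at hint
  rw [← hint]
  have hconst : ∀ c : ℝ≥0∞, ∫⁻ _ in Q, c = c := fun c => by simp [hQ1]
  constructor
  · calc volume (P ∩ F) = ∫⁻ _ in Q, volume (P ∩ F) := (hconst _).symm
      _ ≤ ∫⁻ s in Q, (volume (P ∩ (fun t => t - fun j => s j / n j) ⁻¹' F) + δ) :=
        setLIntegral_mono' hQ fun s hs => (measure_inter_le_add_symmDiff _ _ _ _).trans
          (add_le_add_right (by rw [symmDiff_comm]; exact hδ s hs) _)
      _ = _ := by rw [lintegral_add_right _ measurable_const, hconst]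
  · calc _ ≤ ∫⁻ _ in Q, (volume (P ∩ F) + δ) :=
        setLIntegral_mono' hQ fun s hs => (measure_inter_le_add_symmDiff _ _ _ _).trans
          (add_le_add_right (hδ s hs) _)
      _ = _ := hconst _

/-- For Borel sets `E, F ⊆ [0,1)^d`,
`μ_L(T_n⁻¹(E) ∩ F) → μ_L(E) μ_L(F)` as all coordinates of `n` tend to infinity,
where `T_n(t)_j = n_j t_j mod 1`. -/
theorem stmt2 (d : ℕ) (E F : Set (Fin d → ℝ))
    (hE : MeasurableSet E) (hF : MeasurableSet F)
    (hEsub : E ⊆ Set.pi Set.univ fun _ => Set.Ico (0:ℝ) 1)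
    (hFsub : F ⊆ Set.pi Set.univ fun _ => Set.Ico (0:ℝ) 1)
    (T : (Fin d → ℕ) → (Fin d → ℝ) → (Fin d → ℝ))
    (hT : ∀ n t j, T n t j = Int.fract ((n j : ℝ) * t j)) :
    ∀ ε > 0, ∃ N : ℕ, ∀ n : Fin d → ℕ, (∀ j, N < n j) →
      |(volume (T n ⁻¹' E ∩ F)).toReal
        - (volume E).toReal * (volume F).toReal| < ε := by
  intro ε hε
  have hfin : ∀ A : Set (Fin d → ℝ), A ⊆ (univ.pi fun _ => Ico (0 : ℝ) 1) → volume A ≠ ∞ :=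
    fun A hA => measure_ne_top_of_subset hA (by simp [volume_pi_pi])
  have hF' := hfin F hFsub
  have hE' := hfin E hEsub
  have hev := (ENNReal.tendsto_nhds_zero.1 (tendsto_volume_sub_preimage_symmDiff hF hF'))
    (ENNReal.ofReal (ε / 2)) (by simpa using hε)
  obtain ⟨r, hr, hball⟩ := Metric.eventually_nhds_iff.1 hev
  obtain ⟨N, hN⟩ := exists_nat_gt (1 / r)
  refine ⟨N, fun n hn => ?_⟩
  have hnpos : ∀ j, (0 : ℝ) < n j := fun j => Nat.cast_pos.2 ((Nat.zero_le N).trans_lt (hn j))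
  have hset : T n ⁻¹' E = {t | (fun j => Int.fract ((n j : ℝ) * t j)) ∈ E} := by
    ext t
    rw [mem_preimage, show T n t = _ from funext (hT n t), mem_ofPred_eq]
  obtain ⟨h1, h2⟩ := volume_fract_preimage_inter_bounds hE hEsub hF' (fun j => (n j : ℝ))
    (fun j => (hnpos j).ne') (δ := ENNReal.ofReal (ε / 2)) fun s hs => by
      refine hball ?_
      rw [dist_zero_right, pi_norm_lt_iff hr]
      intro j
      have hs := hs j (mem_univ j)
      rw [Real.norm_of_nonneg (div_nonneg hs.1 (hnpos j).le), div_lt_iff₀ (hnpos j)]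
      have hNn : (N : ℝ) < n j := Nat.cast_lt.2 (hn j)
      have := (div_lt_iff₀' hr).1 (hN.trans hNn)
      exact hs.2.trans this
  rw [← hset] at h1 h2
  have hA' : volume (T n ⁻¹' E ∩ F) ≠ ∞ := measure_ne_top_of_subset inter_subset_right hF'
  have h1' := ENNReal.toReal_mono (by finiteness) h1
  have h2' := ENNReal.toReal_mono (by finiteness) h2
  rw [ENNReal.toReal_add (by finiteness) (by finiteness), ENNReal.toReal_mul,
    ENNReal.toReal_ofReal (by positivity)] at h1' h2'
  rw [abs_lt]
  constructor <;> linarith
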